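/- Suppose there exist ε, w ∈ (0,1) and an integer p ≥ 1 such that for every t ∈ ℕ the interval [t, t+p) is (ε,w)-defected (a semi-periodic defected network). Then the dynamics is exponentially stable: for all t ≥ τ ≥ 0, ‖Φ(t, τ)‖ ≤ c·γ^{t−τ}, with growth factor c = (1 − ε w^p)^{−p} and decay rate γ = (1 − ε w^p)^{1/p} ∈ (0,1). -/

import Mathlib

open Matrix Finset Filter

noncomputable section

/-- Maximum absolute row-sum norm of a matrix. -/
noncomputable def rowNorm {n : ℕ} (A : Matrix (Fin n) (Fin n) ℝ) : ℝ :=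
  ⨆ i, ∑ j, |A i j|

/-- Auxiliary product: `PhiAux lam W τ k = Λ(τ+k-1)W(τ+k-1) ⋯ Λ(τ)W(τ)`. -/
noncomputable def PhiAux {n : ℕ} (lam : ℕ → Fin n → ℝ)
    (W : ℕ → Matrix (Fin n) (Fin n) ℝ) (τ : ℕ) : ℕ → Matrix (Fin n) (Fin n) ℝ
  | 0 => 1
  | k + 1 => (Matrix.diagonal (lam (τ + k)) * W (τ + k)) * PhiAux lam W τ k

/-- State-transition matrix `Φ(t,τ) = Λ(t−1)W(t−1) ⋯ Λ(τ)W(τ)`, `Φ(τ,τ) = I`. -/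
noncomputable def Phi {n : ℕ} (lam : ℕ → Fin n → ℝ)
    (W : ℕ → Matrix (Fin n) (Fin n) ℝ) (t τ : ℕ) : Matrix (Fin n) (Fin n) ℝ :=
  PhiAux lam W τ (t - τ)

/-- The interval `[t0, td)` is `(ε,w)`-defected: every agent `i` is reached by an
influential temporal path from an `ε`-stubborn source. -/
def IsDefected {n : ℕ} (lam : ℕ → Fin n → ℝ) (W : ℕ → Matrix (Fin n) (Fin n) ℝ)
    (ε w : ℝ) (t0 td : ℕ) : Prop :=
  ∀ i : Fin n, ∃ τ : ℕ, t0 ≤ τ ∧ τ < td ∧ ∃ a : ℕ → Fin n, a td = i ∧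
    lam τ (a (τ + 1)) ≤ 1 - ε ∧
    ∀ k, τ + 1 ≤ k → k + 1 ≤ td → w ≤ W k (a (k + 1)) (a k)

theorem Phi_succ {n : ℕ} (lam : ℕ → Fin n → ℝ) (W : ℕ → Matrix (Fin n) (Fin n) ℝ)
    {t τ : ℕ} (h : τ ≤ t) :
    Phi lam W (t + 1) τ = Matrix.diagonal (lam t) * W t * Phi lam W t τ := by
  unfold Phi
  rw [Nat.sub_add_comm h, PhiAux, Nat.add_sub_cancel' h]

theorem Phi_nonneg {n : ℕ} {lam : ℕ → Fin n → ℝ} {W : ℕ → Matrix (Fin n) (Fin n) ℝ}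
    (hW0 : ∀ t i j, 0 ≤ W t i j) (hlam0 : ∀ t i, 0 ≤ lam t i) {t τ : ℕ} (h : τ ≤ t)
    (i j : Fin n) : 0 ≤ Phi lam W t τ i j := by
  induction t, h using Nat.le_induction generalizing i with
  | base =>
    rw [Phi, Nat.sub_self, PhiAux, Matrix.one_apply]
    split_ifs <;> norm_num
  | succ t h ih =>
    rw [Phi_succ lam W h, Matrix.mul_apply]
    refine Finset.sum_nonneg fun l _ => mul_nonneg ?_ (ih l)
    rw [Matrix.diagonal_mul]
    exact mul_nonneg (hlam0 t i) (hW0 t i l)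

/-- Row sums of the transition matrix follow the autonomous dynamics. -/
theorem Phi_rowSum_succ {n : ℕ} (lam : ℕ → Fin n → ℝ) (W : ℕ → Matrix (Fin n) (Fin n) ℝ)
    {t τ : ℕ} (h : τ ≤ t) (i : Fin n) :
    ∑ j, Phi lam W (t + 1) τ i j = lam t i * ∑ l, W t i l * ∑ j, Phi lam W t τ l j := by
  have hentry : ∀ j, Phi lam W (t + 1) τ i j = ∑ l, lam t i * (W t i l * Phi lam W t τ l j) := by
    intro j
    rw [Phi_succ lam W h, Matrix.mul_assoc, Matrix.diagonal_mul, Matrix.mul_apply,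
      Finset.mul_sum]
  simp_rw [hentry, Finset.mul_sum]
  exact Finset.sum_comm

/-- An average of values at most `M` drops by the weight of an entry times its deficit. -/
theorem sum_mul_le_sub_of_stochastic {ι : Type*} [Fintype ι] {v x : ι → ℝ} {M w d : ℝ}
    (hv0 : ∀ j, 0 ≤ v j) (hv1 : ∑ j, v j = 1) (hx : ∀ j, x j ≤ M) {j₀ : ι}
    (hw : w ≤ v j₀) (hd : 0 ≤ d) (hj₀ : x j₀ ≤ M - d) :
    ∑ j, v j * x j ≤ M - w * d := by
  have hle : v j₀ * (M - x j₀) ≤ ∑ j, v j * (M - x j) :=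
    Finset.single_le_sum (f := fun j => v j * (M - x j))
      (fun j _ => mul_nonneg (hv0 j) (sub_nonneg.2 (hx j))) (Finset.mem_univ j₀)
  have hsum : ∑ j, v j * (M - x j) = M - ∑ j, v j * x j := by
    simp_rw [mul_sub, Finset.sum_sub_distrib, ← Finset.sum_mul, hv1, one_mul]
  have hwd : w * d ≤ v j₀ * (M - x j₀) :=
    mul_le_mul hw (by linarith) hd (hv0 j₀)
  linarith

section Trajectory

variable {n : ℕ} {lam : ℕ → Fin n → ℝ} {W : ℕ → Matrix (Fin n) (Fin n) ℝ}
  {x : ℕ → Fin n → ℝ} {t₀ : ℕ} {M : ℝ}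

theorem trajectory_le (hW0 : ∀ t i j, 0 ≤ W t i j) (hW1 : ∀ t i, ∑ j, W t i j = 1)
    (hlam : ∀ t i, 0 ≤ lam t i ∧ lam t i ≤ 1)
    (hx : ∀ t, t₀ ≤ t → ∀ i, x (t + 1) i = lam t i * ∑ j, W t i j * x t j)
    (hM : 0 ≤ M) (h₀ : ∀ i, x t₀ i ≤ M) {t : ℕ} (ht : t₀ ≤ t) (i : Fin n) : x t i ≤ M := by
  induction t, ht using Nat.le_induction generalizing i with
  | base => exact h₀ i
  | succ t h ih =>
    have hsum : ∑ j, W t i j * x t j ≤ M := by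
      simpa using sum_mul_le_sub_of_stochastic (hW0 t i) (hW1 t i) ih (hW0 t i i) le_rfl
        (by simpa using ih i)
    rw [hx t h i]
    exact (mul_le_mul_of_nonneg_left hsum (hlam t i).1).trans
      (mul_le_of_le_one_left hM (hlam t i).2)

/-- A defected interval of length `p` contracts the upper bound by `1 - ε * w ^ p`. -/
theorem trajectory_le_of_isDefected (hW0 : ∀ t i j, 0 ≤ W t i j)
    (hW1 : ∀ t i, ∑ j, W t i j = 1) (hlam : ∀ t i, 0 ≤ lam t i ∧ lam t i ≤ 1)
    (hx : ∀ t, t₀ ≤ t → ∀ i, x (t + 1) i = lam t i * ∑ j, W t i j * x t j)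
    (hM : 0 ≤ M) (h₀ : ∀ i, x t₀ i ≤ M) {ε w : ℝ} (hε : 0 ≤ ε ∧ ε ≤ 1) (hw : 0 ≤ w ∧ w ≤ 1)
    {p : ℕ} (hdef : IsDefected lam W ε w t₀ (t₀ + p)) (i : Fin n) :
    x (t₀ + p) i ≤ (1 - ε * w ^ p) * M := by
  obtain ⟨s, hs₀, hsp, a, rfl, hstub, hpath⟩ := hdef i
  have hle : ∀ t, t₀ ≤ t → ∀ i, x t i ≤ M := fun t ht i =>
    trajectory_le hW0 hW1 hlam hx hM h₀ ht i
  have havg : ∀ t, t₀ ≤ t → ∀ i, ∑ j, W t i j * x t j ≤ M := fun t ht i => by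
    simpa using sum_mul_le_sub_of_stochastic (hW0 t i) (hW1 t i) (hle t ht) (hW0 t i i) le_rfl
      (by simpa using hle t ht i)
  have halong : ∀ k, s + 1 + k ≤ t₀ + p →
      x (s + 1 + k) (a (s + 1 + k)) ≤ M - ε * w ^ k * M := by
    intro k
    induction k with
    | zero =>
      intro _
      rw [Nat.add_zero, hx s hs₀]
      have h₁ := mul_le_mul_of_nonneg_left (havg s hs₀ (a (s + 1))) (hlam s (a (s + 1))).1
      have h₂ := mul_le_mul_of_nonneg_right hstub hM
      rw [pow_zero]
      linarith
    | succ k ih =>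
      intro hk
      have hd : 0 ≤ ε * w ^ k * M := mul_nonneg (mul_nonneg hε.1 (pow_nonneg hw.1 k)) hM
      have hsum := sum_mul_le_sub_of_stochastic (hW0 _ _) (hW1 _ _)
        (hle (s + 1 + k) (by omega)) (hpath (s + 1 + k) (by omega) (by omega)) hd
        (ih (by omega))
      have hlow : 0 ≤ M - w * (ε * w ^ k * M) := by
        have h₁ : w * (ε * w ^ k) ≤ 1 :=
          mul_le_one₀ hw.2 (mul_nonneg hε.1 (pow_nonneg hw.1 k))
            (mul_le_one₀ hε.2 (pow_nonneg hw.1 k) (pow_le_one₀ hw.1 hw.2))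
        nlinarith
      rw [← Nat.add_assoc, hx _ (by omega)]
      calc _ ≤ lam (s + 1 + k) (a (s + 1 + k + 1)) * (M - w * (ε * w ^ k * M)) :=
            mul_le_mul_of_nonneg_left hsum (hlam _ _).1
        _ ≤ M - w * (ε * w ^ k * M) := mul_le_of_le_one_left hlow (hlam _ _).2
        _ = M - ε * w ^ (k + 1) * M := by ring
  have hend := halong (t₀ + p - (s + 1)) (by omega)
  rw [Nat.add_sub_cancel' (by omega : s + 1 ≤ t₀ + p)] at hend
  have hpow : w ^ p ≤ w ^ (t₀ + p - (s + 1)) := pow_le_pow_of_le_one hw.1 hw.2 (by omega)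
  have := mul_le_mul_of_nonneg_right (mul_le_mul_of_nonneg_left hpow hε.1) hM
  linarith

theorem trajectory_le_pow (hW0 : ∀ t i j, 0 ≤ W t i j)
    (hW1 : ∀ t i, ∑ j, W t i j = 1) (hlam : ∀ t i, 0 ≤ lam t i ∧ lam t i ≤ 1)
    (hx : ∀ t, t₀ ≤ t → ∀ i, x (t + 1) i = lam t i * ∑ j, W t i j * x t j)
    (hM : 0 ≤ M) (h₀ : ∀ i, x t₀ i ≤ M) {ε w : ℝ} (hε : 0 ≤ ε ∧ ε ≤ 1) (hw : 0 ≤ w ∧ w ≤ 1)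
    {p : ℕ} (hdef : ∀ t, IsDefected lam W ε w t (t + p)) (m : ℕ) (i : Fin n) :
    x (t₀ + p * m) i ≤ (1 - ε * w ^ p) ^ m * M := by
  have hq : 0 ≤ 1 - ε * w ^ p :=
    sub_nonneg.2 (mul_le_one₀ hε.2 (pow_nonneg hw.1 p) (pow_le_one₀ hw.1 hw.2))
  induction m generalizing i with
  | zero => simpa using h₀ i
  | succ m ih =>
    have := trajectory_le_of_isDefected hW0 hW1 hlam (fun t ht => hx t (by omega))
      (mul_nonneg (pow_nonneg hq m) hM) ih hε hw (hdef _) i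
    rw [mul_add_one, ← add_assoc, pow_succ', mul_assoc]
    exact this

end Trajectory

/-- Rounding the exponent `k / p` down costs at most a factor `(q ^ p)⁻¹`. -/
theorem pow_div_le_inv_mul_rpow_inv_pow {q : ℝ} (hq0 : 0 < q) (hq1 : q ≤ 1) {p : ℕ}
    (hp : 1 ≤ p) (k : ℕ) : q ^ (k / p) ≤ (q ^ p)⁻¹ * (q ^ ((p : ℝ))⁻¹) ^ k := by
  have hp0 : (0 : ℝ) < p := by exact_mod_cast hp
  have hp1 : (1 : ℝ) ≤ p := by exact_mod_cast hp
  rw [← Real.rpow_natCast q (k / p), ← Real.rpow_natCast q p, ← Real.rpow_neg hq0.le,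
    ← Real.rpow_mul_natCast hq0.le, ← Real.rpow_add hq0]
  refine Real.rpow_le_rpow_of_exponent_ge hq0 hq1 ?_
  have hk : (k : ℝ) ≤ p * ((k / p : ℕ) + 1) := by
    exact_mod_cast (Nat.lt_mul_div_succ k hp).le
  have hdiv : (p : ℝ)⁻¹ * k ≤ (k / p : ℕ) + 1 := by
    rwa [inv_mul_le_iff₀ hp0]
  linarith

/-- semi-periodic defected networks are exponentially stable with
growth factor `c = (1 − ε w^p)^{−p}` and decay rate `γ = (1 − ε w^p)^{1/p}`. -/
theorem spfj_exponential_stability {n : ℕ} (hn : 1 ≤ n)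
    (lam : ℕ → Fin n → ℝ) (W : ℕ → Matrix (Fin n) (Fin n) ℝ)
    (hW0 : ∀ t i j, 0 ≤ W t i j) (hW1 : ∀ t i, ∑ j, W t i j = 1)
    (hlam : ∀ t i, 0 ≤ lam t i ∧ lam t i ≤ 1)
    (ε w : ℝ) (hε : 0 < ε ∧ ε < 1) (hw : 0 < w ∧ w < 1)
    (p : ℕ) (hp : 1 ≤ p)
    (hdef : ∀ t : ℕ, IsDefected lam W ε w t (t + p)) :
    (0 < (1 - ε * w ^ p) ^ ((p : ℝ))⁻¹ ∧ (1 - ε * w ^ p) ^ ((p : ℝ))⁻¹ < 1) ∧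
    ∀ τ t : ℕ, τ ≤ t →
      rowNorm (Phi lam W t τ) ≤
        ((1 - ε * w ^ p) ^ p)⁻¹ * ((1 - ε * w ^ p) ^ ((p : ℝ))⁻¹) ^ (t - τ) := by
  have hwp0 : 0 < ε * w ^ p := mul_pos hε.1 (pow_pos hw.1 p)
  have hwp1 : ε * w ^ p < 1 :=
    (mul_le_of_le_one_right hε.1.le (pow_le_one₀ hw.1.le hw.2.le)).trans_lt hε.2
  have hq0 : 0 < 1 - ε * w ^ p := sub_pos.2 hwp1
  have hq1 : 1 - ε * w ^ p < 1 := sub_lt_self 1 hwp0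
  have hp0 : (0 : ℝ) < p := by exact_mod_cast hp
  refine ⟨⟨Real.rpow_pos_of_pos hq0 _, Real.rpow_lt_one hq0.le hq1 (inv_pos.2 hp0)⟩, ?_⟩
  intro τ t hτ
  have : Nonempty (Fin n) := ⟨⟨0, hn⟩⟩
  refine ciSup_le fun i => ?_
  simp_rw [abs_of_nonneg (Phi_nonneg hW0 (fun t i => (hlam t i).1) hτ i _)]
  refine le_trans ?_ (pow_div_le_inv_mul_rpow_inv_pow hq0 hq1.le hp (t - τ))
  have hblock := trajectory_le_pow (x := fun t i => ∑ j, Phi lam W t τ i j) hW0 hW1 hlam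
    (fun _ ht i => Phi_rowSum_succ lam W ht i) zero_le_one
    (fun i => by simp [Phi, PhiAux, Matrix.one_apply]) ⟨hε.1.le, hε.2.le⟩ ⟨hw.1.le, hw.2.le⟩
    hdef ((t - τ) / p)
  have hmul := Nat.mul_div_le (t - τ) p
  simp only [mul_one] at hblock
  exact trajectory_le (x := fun t i => ∑ j, Phi lam W t τ i j) hW0 hW1 hlam
    (fun _ ht i => Phi_rowSum_succ lam W (by omega) i) (pow_nonneg hq0.le _) hblock
    (by omega) i
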